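/- arXiv:2303.13759 — 2 statements merged into one kernel-verified Lean document; each statement's English description precedes it below -/
import Mathlib

section
/- The coloring of C_{10}(1,3) given by c(v_0)=1, c(v_2)=2, c(v_4)=2, c(v_6)=3, c(v_8)=3, c(v_5)=1, c(v_7)=4, c(v_9)=5, c(v_1)=4, c(v_3)=5 is a proper coloring with 5 colors whose only color-preserving automorphism is the identity; hence χ_D(C_{10}(1,3)) = 5. -/
open SimpleGraph

/-- A coloring is proper if adjacent vertices receive different colors. -/
def IsProperColoring {V α : Type*} (G : SimpleGraph V) (c : V → α) : Prop :=
  ∀ x y, G.Adj x y → c x ≠ c y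

/-- A coloring is distinguishing if the only color-preserving automorphism is the identity. -/
def IsDistinguishing {V α : Type*} (G : SimpleGraph V) (c : V → α) : Prop :=
  ∀ φ : G ≃g G, (∀ v, c (φ v) = c v) → ∀ v, φ v = v

/-- In `C_10(1,3)`, i.e. `K_{5,5}` minus a perfect matching, the neighbours of a vertex are the
vertices of the other parity except its antipode. -/
theorem circulantGraph_ten_adj (x y : ZMod 10) :
    (circulantGraph ({1, 3} : Set (ZMod 10))).Adj x y ↔
      x - y = 1 ∨ x - y = 3 ∨ x - y = 7 ∨ x - y = 9 := by
  simp only [circulantGraph_adj, Set.mem_insert_iff, Set.mem_singleton_iff]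
  revert x y
  decide

/-- The pairs in `S × T` which may occur as colors of an antipodal pair, when `S` and `T` are the
sets of colors used on the two sides of the bipartition. -/
def antipodalPairs (S T : Finset (Fin 4)) : Finset (Fin 4 × Fin 4) :=
  (S ×ˢ T).filter fun p => (p.1 ∈ T → p.1 = p.2) ∧ (p.2 ∈ S → p.1 = p.2)

theorem card_antipodalPairs_lt (S T : Finset (Fin 4)) : (antipodalPairs S T).card < 5 := by
  revert S T
  decide +kernel

theorem exists_ne_same_colors (f g : Fin 5 → Fin 4) (h : ∀ i j, i ≠ j → f i ≠ g j) :
    ∃ i j, i ≠ j ∧ f i = f j ∧ g i = g j := by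
  obtain ⟨i, -, j, -, hij, he⟩ := Finset.exists_ne_map_eq_of_card_lt_of_maps_to
    (s := Finset.univ) (t := antipodalPairs (Finset.univ.image f) (Finset.univ.image g))
    (f := fun i => (f i, g i)) (by simpa using card_antipodalPairs_lt _ _) (by
      intro i _
      simp only [antipodalPairs, Finset.coe_filter, Set.mem_ofPred_eq, Finset.mem_product,
        Finset.mem_image, Finset.mem_univ, true_and]
      refine ⟨⟨⟨i, rfl⟩, ⟨i, rfl⟩⟩, ?_, ?_⟩
      · rintro ⟨j, hj⟩
        by_cases hij : i = j
        · rw [← hj, hij]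
        · exact absurd hj.symm (h i j hij)
      · rintro ⟨j, hj⟩
        by_cases hij : j = i
        · rw [← hj, hij]
        · exact absurd hj (h j i hij))
  exact ⟨i, j, hij, (Prod.ext_iff.mp he).1, (Prod.ext_iff.mp he).2⟩

/-- The `i`-th even vertex of the 10-cycle. -/
def evenVertex (i : Fin 5) : ZMod 10 := 2 * (i.val : ZMod 10)

/-- Exchange two even vertices, and simultaneously their antipodes. -/
def antipodalSwap (i j : Fin 5) : Equiv.Perm (ZMod 10) :=
  (Equiv.swap (evenVertex i) (evenVertex j)).trans
    (Equiv.swap (evenVertex i + 5) (evenVertex j + 5))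

theorem antipodalSwap_adj (i j : Fin 5) (x y : ZMod 10) :
    (circulantGraph ({1, 3} : Set (ZMod 10))).Adj (antipodalSwap i j x) (antipodalSwap i j y) ↔
      (circulantGraph ({1, 3} : Set (ZMod 10))).Adj x y := by
  simp only [circulantGraph_ten_adj]
  revert i j x y
  decide +kernel

theorem antipodalSwap_cases (i j : Fin 5) (v : ZMod 10) :
    antipodalSwap i j v = v ∨
      (v = evenVertex i ∧ antipodalSwap i j v = evenVertex j) ∨
      (v = evenVertex j ∧ antipodalSwap i j v = evenVertex i) ∨
      (v = evenVertex i + 5 ∧ antipodalSwap i j v = evenVertex j + 5) ∨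
      (v = evenVertex j + 5 ∧ antipodalSwap i j v = evenVertex i + 5) := by
  revert i j v
  decide +kernel

theorem antipodalSwap_apply_ne (i j : Fin 5) (hij : i ≠ j) :
    antipodalSwap i j (evenVertex i) ≠ evenVertex i := by
  revert i j
  decide +kernel

theorem evenVertex_adj (i j : Fin 5) (hij : i ≠ j) :
    (circulantGraph ({1, 3} : Set (ZMod 10))).Adj (evenVertex i) (evenVertex j + 5) := by
  rw [circulantGraph_ten_adj]
  revert i j
  decide +kernel

theorem not_isDistinguishing_of_four_colors (c : ZMod 10 → Fin 4)
    (hc : IsProperColoring (circulantGraph ({1, 3} : Set (ZMod 10))) c) :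
    ¬ IsDistinguishing (circulantGraph ({1, 3} : Set (ZMod 10))) c := by
  intro hd
  obtain ⟨i, j, hij, hf, hg⟩ := exists_ne_same_colors (fun i => c (evenVertex i))
    (fun i => c (evenVertex i + 5)) fun i j hij => hc _ _ (evenVertex_adj i j hij)
  refine antipodalSwap_apply_ne i j hij
    (hd ⟨antipodalSwap i j, antipodalSwap_adj i j _ _⟩ (fun v => ?_) _)
  change c (antipodalSwap i j v) = c v
  rcases antipodalSwap_cases i j v with h | ⟨h, h'⟩ | ⟨h, h'⟩ | ⟨h, h'⟩ | ⟨h, h'⟩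
  · rw [h]
  · rw [h', h]; exact hf.symm
  · rw [h', h]; exact hf
  · rw [h', h]; exact hg.symm
  · rw [h', h]; exact hg

/-- A proper distinguishing 5-coloring of `C_10(1,3)`. -/
def fiveColoring : ZMod 10 → Fin 5 :=
  (![0, 3, 1, 4, 1, 0, 2, 3, 2, 4] : Fin 10 → Fin 5)

theorem isProperColoring_fiveColoring :
    IsProperColoring (circulantGraph ({1, 3} : Set (ZMod 10))) fiveColoring := by
  simp only [IsProperColoring, circulantGraph_ten_adj]
  decide +kernel

theorem isDistinguishing_fiveColoring :
    IsDistinguishing (circulantGraph ({1, 3} : Set (ZMod 10))) fiveColoring := by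
  intro φ hφ
  have hadj (x y : ZMod 10) := φ.map_adj_iff (v := x) (w := y)
  simp only [circulantGraph_ten_adj] at hadj
  have key : ∀ v w w' : ZMod 10, v ≠ 0 → v ≠ 5 → fiveColoring w = fiveColoring v →
      fiveColoring w' = fiveColoring (v + 5) →
      ¬ (w - w' = 1 ∨ w - w' = 3 ∨ w - w' = 7 ∨ w - w' = 9) → w = v := by
    decide +kernel
  have key' : ∀ v w : ZMod 10, (v = 0 ∨ v = 5) → fiveColoring w = fiveColoring v →
      ((w - 7 = 1 ∨ w - 7 = 3 ∨ w - 7 = 7 ∨ w - 7 = 9) ↔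
        (v - 7 = 1 ∨ v - 7 = 3 ∨ v - 7 = 7 ∨ v - 7 = 9)) → w = v := by
    decide +kernel
  have antipode : ∀ v : ZMod 10,
      ¬ (v - (v + 5) = 1 ∨ v - (v + 5) = 3 ∨ v - (v + 5) = 7 ∨ v - (v + 5) = 9) := by
    decide
  have fixed (v : ZMod 10) (hv : v ≠ 0) (hv' : v ≠ 5) : φ v = v :=
    key v (φ v) (φ (v + 5)) hv hv' (hφ v) (hφ (v + 5)) (mt (hadj _ _).mp (antipode v))
  intro v
  by_cases hv : v = 0 ∨ v = 5
  · have h := hadj v 7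
    rw [fixed 7 (by decide) (by decide)] at h
    exact key' v (φ v) hv (hφ v) h
  · exact fixed v (fun h => hv (.inl h)) fun h => hv (.inr h)

/-- The explicit coloring `c(v_0)=1, c(v_2)=2, c(v_4)=2, c(v_6)=3, c(v_8)=3, c(v_5)=1,
c(v_7)=4, c(v_9)=5, c(v_1)=4, c(v_3)=5` of `C_10(1,3)` is a proper distinguishing
5-coloring, and no proper 4-coloring is distinguishing; hence `χ_D(C_10(1,3)) = 5`. -/
theorem stmt_16 (c : ZMod 10 → Fin 5)
    (h0 : c 0 = 0) (h2 : c 2 = 1) (h4 : c 4 = 1) (h6 : c 6 = 2) (h8 : c 8 = 2)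
    (h5 : c 5 = 0) (h7 : c 7 = 3) (h9 : c 9 = 4) (h1 : c 1 = 3) (h3 : c 3 = 4) :
    IsProperColoring (circulantGraph ({1, 3} : Set (ZMod 10))) c ∧
    IsDistinguishing (circulantGraph ({1, 3} : Set (ZMod 10))) c ∧
    ¬ ∃ c' : ZMod 10 → Fin 4,
      IsProperColoring (circulantGraph ({1, 3} : Set (ZMod 10))) c' ∧
      IsDistinguishing (circulantGraph ({1, 3} : Set (ZMod 10))) c' := by
  obtain rfl : c = fiveColoring := by
    funext v
    have hv : v = 0 ∨ v = 1 ∨ v = 2 ∨ v = 3 ∨ v = 4 ∨ v = 5 ∨ v = 6 ∨ v = 7 ∨ v = 8 ∨ v = 9 := by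
      revert v
      decide
    rcases hv with rfl | rfl | rfl | rfl | rfl | rfl | rfl | rfl | rfl | rfl <;> assumption
  refine ⟨isProperColoring_fiveColoring, isDistinguishing_fiveColoring, ?_⟩
  rintro ⟨c', hc', hd⟩
  exact not_isDistinguishing_of_four_colors c' hc' hd
end

section
/- If a reflection automorphism of C_n(1, k) (a map of the form v_i ↦ v_{a−i} for some fixed a) preserves a proper coloring of C_n(1, k) with 1 < k < n/2, then n is even and k is odd. -/
open SimpleGraph

/-- A coloring preserved by the reflection `i ↦ a - i` and proper on the circulant graph of `s`
excludes `2 * i - a` from being a nonzero element of `s`. -/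
lemma two_mul_ne_add_of_reflection {G α : Type*} [CommRing G] {s : Set G} {c : G → α} {a : G}
    (hp : ∀ x y, (circulantGraph s).Adj x y → c x ≠ c y) (href : ∀ i, c (a - i) = c i)
    {d : G} (hd : d ∈ s) (hd0 : d ≠ 0) (i : G) : 2 * i ≠ a + d := by
  intro h
  have hsub : i - (a - i) = d := by linear_combination h
  refine hp i (a - i) ?_ (href i).symm
  rw [circulantGraph_adj, hsub]
  exact ⟨fun hi => hd0 (by rw [← hsub, ← hi, sub_self]), Or.inl hd⟩

/-- If a reflection `v_i ↦ v_{a−i}` preserves a proper coloring of `C_n(1, k)` with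
`1 < k < n/2`, then `n` is even and `k` is odd. -/
theorem stmt_18 (n k : ℕ) (hk1 : 1 < k) (hk2 : 2 * k < n) {α : Type*}
    (c : ZMod n → α)
    (hp : ∀ x y, (circulantGraph ({1, (k : ZMod n)} : Set (ZMod n))).Adj x y → c x ≠ c y)
    (a : ZMod n) (href : ∀ i : ZMod n, c (a - i) = c i) :
    Even n ∧ Odd k := by
  have : NeZero n := ⟨by omega⟩
  have key (d : ℕ) (hd : d = 1 ∨ d = k) (m e : ℕ) : 2 * m ≠ a.val + d + e * n := by
    intro h
    have hd0 : (d : ZMod n) ≠ 0 := by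
      rw [Ne, ZMod.natCast_eq_zero_iff]
      exact Nat.not_dvd_of_pos_of_lt (by omega) (by omega)
    refine two_mul_ne_add_of_reflection hp href (d := (d : ZMod n))
      (by rcases hd with rfl | rfl <;> simp) hd0 (m : ZMod n) ?_
    simpa using congrArg (Nat.cast : ℕ → ZMod n) h
  have h₁ := key 1 (Or.inl rfl) ((a.val + 1) / 2) 0
  have h₂ := key 1 (Or.inl rfl) ((a.val + 1 + n) / 2) 1
  have h₃ := key k (Or.inr rfl) ((a.val + k) / 2) 0
  rw [Nat.even_iff, Nat.odd_iff]
  omega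
end
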